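/- arXiv:1809.08271 — 4 statements merged into one kernel-verified Lean document; each statement's English description precedes it below -/
import Mathlib

section
/- Let 𝒱 be a finite set of real numbers and m, n₁ positive integers. There exists a constant κ, depending only on 𝒱, m and n₁, such that: for every stage-1 FCBM 𝔸 with characterization numbers (m, n₁) all of whose entries lie in 𝒱, every maximal nonsingular submatrix 𝔸̂ of 𝔸, and every row vector u with as many entries as 𝔸̂ has rows, ‖u‖₁ ≤ κ ‖u 𝔸̂‖₁. In particular, κ does not depend on the number of diagonal blocks of 𝔸. -/
open Matrix

/-- `IsFCBM m ns k R C fR fC M` says that the matrix `M : Matrix R C ℝ` is a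
stage-`k` finite coupling block matrix (FCBM) with characterization numbers
`(m, ns 1, …, ns k)`.  A stage-`0` FCBM is a finite matrix with `m` columns
and full column rank.  For `k ≥ 1`, the matrix has full column rank and, after
suitable permutations of its rows and columns (expressed here by bijections of
the index types), it can be written as `(H, E)`, where `H` is block diagonal
with finitely many blocks, each block being a stage-`(k-1)` FCBM with
characterization numbers `(m, ns 1, …, ns (k-1))` and all blocks having the
same number `p` of columns, and `E` has `ns k` columns, all of its entries
lying in `{0, -1}`. -/
def IsFCBM (m : ℕ) (ns : ℕ → ℕ) :
    (k : ℕ) → (R C : Type) → Fintype R → Fintype C → Matrix R C ℝ → Prop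
  | 0, R, C, _, _, M =>
      Nonempty (C ≃ Fin m) ∧
      LinearIndependent ℝ (fun j : C => fun i : R => M i j)
  | (k + 1), R, C, _, _, M =>
      LinearIndependent ℝ (fun j : C => fun i : R => M i j) ∧
      ∃ (N p : ℕ) (B : Fin N → Type) (fB : ∀ i, Fintype (B i))
        (e : R ≃ (Σ i : Fin N, B i)) (f : C ≃ ((Fin N × Fin p) ⊕ Fin (ns (k + 1)))),
        (∀ (r : R) (i : Fin N) (j : Fin p),
            (e r).1 ≠ i → M r (f.symm (Sum.inl (i, j))) = 0) ∧
        (∀ (r : R) (j : Fin (ns (k + 1))),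
            M r (f.symm (Sum.inr j)) = 0 ∨ M r (f.symm (Sum.inr j)) = -1) ∧
        (∀ i : Fin N,
          IsFCBM m ns k (B i) (Fin p) (fB i) (Fin.fintype p)
            (fun (br : B i) (bj : Fin p) => M (e.symm ⟨i, br⟩) (f.symm (Sum.inl (i, bj)))))

open Finset in
/-- A matrix whose rows are linearly independent expands the `ℓ¹` norm of row vectors
by at least a positive factor. -/
theorem exists_sum_abs_le_vecMul {ρ γ : Type*} [Fintype ρ] [Fintype γ] (A : Matrix ρ γ ℝ)
    (hA : ∀ u, u ᵥ* A = 0 → u = 0) :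
    ∃ κ : ℝ, 0 ≤ κ ∧ ∀ u, ∑ r, |u r| ≤ κ * ∑ c, |(u ᵥ* A) c| := by
  have hker : LinearMap.ker A.vecMulLinear = ⊥ :=
    LinearMap.ker_eq_bot'.2 fun u hu => hA u (by simpa using hu)
  obtain ⟨K, -, hK⟩ := A.vecMulLinear.exists_antilipschitzWith hker
  refine ⟨Fintype.card ρ * K, by positivity, fun u => ?_⟩
  have h1 : ‖u‖ ≤ K * ‖u ᵥ* A‖ := by
    simpa using hK.le_mul_dist u 0
  have h2 : ‖u ᵥ* A‖ ≤ ∑ c, |(u ᵥ* A) c| := by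
    refine (pi_norm_le_iff_of_nonneg (sum_nonneg fun _ _ => abs_nonneg _)).2 fun c => ?_
    exact single_le_sum (f := fun c => |(u ᵥ* A) c|) (fun _ _ => abs_nonneg _) (mem_univ c)
  calc ∑ r, |u r| ≤ ∑ _r : ρ, ‖u‖ := sum_le_sum fun r _ => norm_le_pi_norm u r
    _ = Fintype.card ρ * ‖u‖ := by simp
    _ ≤ Fintype.card ρ * (K * ∑ c, |(u ᵥ* A) c|) := by gcongr; exact h1.trans (by gcongr)
    _ = _ := by ring

/-- The constant of `exists_sum_abs_le_vecMul` is uniform over all matrices of a given size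
with entries in a fixed finite set. -/
theorem exists_uniform_sum_abs_le_vecMul_fin (V : Finset ℝ) (a b : ℕ) :
    ∃ κ : ℝ, 0 ≤ κ ∧ ∀ A : Matrix (Fin a) (Fin b) ℝ, (∀ i j, A i j ∈ V) →
      (∀ u, u ᵥ* A = 0 → u = 0) → ∀ u, ∑ r, |u r| ≤ κ * ∑ c, |(u ᵥ* A) c| := by
  classical
  let F : (Fin a → Fin b → V) → Matrix (Fin a) (Fin b) ℝ := fun f i j => f i j
  have key : ∀ f, ∃ κ : ℝ, 0 ≤ κ ∧ ((∀ u, u ᵥ* F f = 0 → u = 0) →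
      ∀ u, ∑ r, |u r| ≤ κ * ∑ c, |(u ᵥ* F f) c|) := by
    intro f
    by_cases h : ∀ u, u ᵥ* F f = 0 → u = 0
    · obtain ⟨κ, h0, h1⟩ := exists_sum_abs_le_vecMul (F f) h
      exact ⟨κ, h0, fun _ => h1⟩
    · exact ⟨0, le_rfl, fun h' => absurd h' h⟩
  choose κ hκ0 hκ using key
  refine ⟨∑ f, κ f, Finset.sum_nonneg fun f _ => hκ0 f, fun A hA hinj u => ?_⟩
  have h := hκ (fun i j => ⟨A i j, hA i j⟩) hinj u
  refine h.trans ?_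
  gcongr
  exact Finset.single_le_sum (f := κ) (fun f _ => hκ0 f) (Finset.mem_univ _)

/-- Uniform version of `exists_sum_abs_le_vecMul` for submatrices, given by sets of rows and
columns of bounded size, of matrices with entries in a fixed finite set. -/
theorem exists_uniform_sum_abs_le_vecMul (V : Finset ℝ) (s : ℕ) :
    ∃ κ : ℝ, 0 ≤ κ ∧ ∀ {ρ γ : Type} [Fintype ρ] (A : Matrix ρ γ ℝ),
      (∀ i j, A i j ∈ V) → ∀ (P : Finset ρ) (Q : Finset γ), P.card ≤ s → Q.card ≤ s →
      (∀ u : ρ → ℝ, (∀ r ∉ P, u r = 0) → (∀ c ∈ Q, (u ᵥ* A) c = 0) → u = 0) →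
      ∀ u : ρ → ℝ, (∀ r ∉ P, u r = 0) → ∑ r, |u r| ≤ κ * ∑ c ∈ Q, |(u ᵥ* A) c| := by
  classical
  choose κ hκ0 hκ using exists_uniform_sum_abs_le_vecMul_fin V
  refine ⟨∑ a ∈ Finset.range (s + 1), ∑ b ∈ Finset.range (s + 1), κ a b,
    Finset.sum_nonneg fun _ _ => Finset.sum_nonneg fun _ _ => hκ0 _ _, ?_⟩
  intro ρ γ _ A hA P Q hP hQ hinj u hu
  let eP : P ≃ Fin P.card := P.equivFin
  let eQ : Q ≃ Fin Q.card := Q.equivFin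
  let A' : Matrix (Fin P.card) (Fin Q.card) ℝ := fun i j => A (eP.symm i) (eQ.symm j)
  have hsum : ∀ F : ρ → ℝ, (∀ r ∉ P, F r = 0) → ∑ i, F (eP.symm i) = ∑ r, F r := by
    intro F hF
    rw [eP.symm.sum_comp (fun r : P => F r), Finset.sum_coe_sort P F]
    exact Finset.sum_subset (Finset.subset_univ _) fun r _ hr => hF r hr
  have hmul : ∀ v : ρ → ℝ, (∀ r ∉ P, v r = 0) → ∀ j,
      ((fun i => v (eP.symm i)) ᵥ* A') j = (v ᵥ* A) (eQ.symm j) := by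
    intro v hv j
    exact hsum (fun r => v r * A r (eQ.symm j)) fun r hr => by simp [hv r hr]
  have hinj' : ∀ v, v ᵥ* A' = 0 → v = 0 := by
    intro v hv
    let v' : ρ → ℝ := fun r => if h : r ∈ P then v (eP ⟨r, h⟩) else 0
    have hv'0 : ∀ r ∉ P, v' r = 0 := fun r hr => by simp [v', hr]
    have hv' : (fun i => v' (eP.symm i)) = v := by
      ext i; simp [v']
    have := hinj v' hv'0 fun c hc => by
      have h := hmul v' hv'0 (eQ ⟨c, hc⟩)
      rw [hv', hv] at h
      simpa using h.symm
    rw [← hv', this]; rfl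
  have h := hκ _ _ A' (fun _ _ => hA _ _) hinj' (fun i => u (eP.symm i))
  rw [hsum (fun r => |u r|) fun r hr => by simp [hu r hr]] at h
  simp only [hmul u hu] at h
  rw [eQ.symm.sum_comp (fun c : Q => |(u ᵥ* A) c|),
    Finset.sum_coe_sort Q (fun c => |(u ᵥ* A) c|)] at h
  refine h.trans ?_
  gcongr
  refine (Finset.single_le_sum (f := fun b => κ P.card b) (fun _ _ => hκ0 _ _)
    (Finset.mem_range.2 (Nat.lt_succ_of_le hQ))).trans ?_
  exact Finset.single_le_sum (f := fun a => ∑ b ∈ Finset.range (s + 1), κ a b)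
    (fun _ _ => Finset.sum_nonneg fun _ _ => hκ0 _ _)
    (Finset.mem_range.2 (Nat.lt_succ_of_le hP))

section BlockColumns

variable {I ρ : Type} [DecidableEq I] {m n : ℕ}
  {A : Matrix ρ ((I × Fin m) ⊕ Fin n) ℝ} {b : ρ → I}

/-- Restricting a row vector to the rows of a set `T` of blocks restricts its product with the
block-diagonal part to the columns of `T`. -/
theorem vecMul_restrict_blocks [Fintype ρ]
    (hzero : ∀ r i j, b r ≠ i → A r (Sum.inl (i, j)) = 0)
    (T : Finset I) (u : ρ → ℝ) (i : I) (j : Fin m) :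
    ((fun r => if b r ∈ T then u r else 0) ᵥ* A) (Sum.inl (i, j)) =
      if i ∈ T then (u ᵥ* A) (Sum.inl (i, j)) else 0 := by
  simp only [Matrix.vecMul, dotProduct]
  split_ifs with hi
  · refine Finset.sum_congr rfl fun r _ => ?_
    by_cases h : b r = i
    · simp [h, hi]
    · simp [hzero r i j h]
  · refine Finset.sum_eq_zero fun r _ => ?_
    by_cases h : b r = i
    · simp [h, hi]
    · simp [hzero r i j h]

/-- The diagonal blocks of a matrix with independent columns have independent columns. -/
theorem block_mulVec_eq_zero [Fintype I]
    (hzero : ∀ r i j, b r ≠ i → A r (Sum.inl (i, j)) = 0)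
    (hcol : ∀ v, A *ᵥ v = 0 → v = 0) (i : I) (v : Fin m → ℝ)
    (hv : (Matrix.of fun (r : {r // b r = i}) j => A r (Sum.inl (i, j))) *ᵥ v = 0) : v = 0 := by
  have h := hcol (Sum.elim (fun x => if x.1 = i then v x.2 else 0) 0) (by
    ext r
    simp only [Matrix.mulVec, dotProduct, Fintype.sum_sum_type, Fintype.sum_prod_type,
      Sum.elim_inl, Sum.elim_inr, Pi.zero_apply, mul_zero, Finset.sum_const_zero, add_zero]
    rw [Finset.sum_eq_single i (fun i' _ hi' => by simp [hi']) (by simp)]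
    by_cases hr : b r = i
    · simpa [Matrix.mulVec, dotProduct] using congrFun hv ⟨r, hr⟩
    · simp [hzero r i _ hr])
  ext j
  simpa using congrFun h (Sum.inl (i, j))

theorem le_card_block [Fintype I] [Fintype ρ]
    (hzero : ∀ r i j, b r ≠ i → A r (Sum.inl (i, j)) = 0)
    (hcol : ∀ v, A *ᵥ v = 0 → v = 0) (i : I) :
    m ≤ (Finset.univ.filter fun r => b r = i).card := by
  classical
  have h := LinearMap.finrank_le_finrank_of_injective
    (f := (Matrix.of fun (r : {r // b r = i}) j => A r (Sum.inl (i, j))).mulVecLin)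
    (LinearMap.ker_eq_bot.1 <| LinearMap.ker_eq_bot'.2 fun v hv =>
      block_mulVec_eq_zero hzero hcol i v (by simpa using hv))
  simpa [Fintype.card_subtype] using h

/-- A square diagonal block of a matrix with independent columns has independent rows. -/
theorem square_block_vecMul_eq_zero [Fintype I] [Fintype ρ]
    (hzero : ∀ r i j, b r ≠ i → A r (Sum.inl (i, j)) = 0)
    (hcol : ∀ v, A *ᵥ v = 0 → v = 0) {i : I}
    (hcard : (Finset.univ.filter fun r => b r = i).card = m) (u : ρ → ℝ)
    (hu : ∀ r, b r ≠ i → u r = 0) (huA : ∀ j, (u ᵥ* A) (Sum.inl (i, j)) = 0) : u = 0 := by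
  classical
  have σ : Fin m ≃ {r // b r = i} :=
    Fintype.equivOfCardEq (by rw [Fintype.card_fin, Fintype.card_subtype, hcard])
  let B : Matrix (Fin m) (Fin m) ℝ := fun k j => A (σ k) (Sum.inl (i, j))
  have hB : Function.Injective B.mulVec := by
    refine (injective_iff_map_eq_zero B.mulVecLin).2 fun v hv => ?_
    refine block_mulVec_eq_zero hzero hcol i v ?_
    ext r
    have h : (B *ᵥ v) (σ.symm r) = 0 := congrFun hv (σ.symm r)
    simpa [B, Matrix.mulVec, dotProduct] using h
  have hB' := Matrix.vecMul_injective_iff_isUnit.2 (Matrix.mulVec_injective_iff_isUnit.1 hB)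
  have h0 : (fun k => u (σ k)) = 0 := by
    refine hB' ?_
    simp only [Matrix.zero_vecMul]
    ext j
    rw [Pi.zero_apply, ← huA j]
    simp only [Matrix.vecMul, dotProduct, B]
    rw [σ.sum_comp (fun r : {r // b r = i} => u r * A r (Sum.inl (i, j))),
      ← Finset.sum_subtype (Finset.univ.filter fun r => b r = i) (by simp)
        (fun r => u r * A r (Sum.inl (i, j)))]
    exact Finset.sum_subset (Finset.subset_univ _) fun r _ hr => by
      simp [hu r (by simpa using hr)]
  ext r
  by_cases hr : b r = i
  · simpa using congrFun h0 (σ.symm ⟨r, hr⟩)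
  · exact hu r hr

end BlockColumns

/-- Uniform `ℓ¹` bound for nonsingular square matrices made of a block-diagonal part with
blocks of `m` columns, and `n` further columns with entries in `[-1, 1]`. -/
theorem exists_sum_abs_le_vecMul_of_blocks (V : Finset ℝ) (m n : ℕ) :
    ∃ κ : ℝ, 0 ≤ κ ∧ ∀ {I ρ : Type} [Fintype I] [Fintype ρ]
      (A : Matrix ρ ((I × Fin m) ⊕ Fin n) ℝ) (b : ρ → I), (∀ r c, A r c ∈ V) →
      (∀ r i j, b r ≠ i → A r (Sum.inl (i, j)) = 0) → (∀ r j, |A r (Sum.inr j)| ≤ 1) →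
      (∀ u, u ᵥ* A = 0 → u = 0) → (∀ v, A *ᵥ v = 0 → v = 0) →
      Fintype.card ρ = Fintype.card I * m + n →
      ∀ u, ∑ r, |u r| ≤ κ * ∑ c, |(u ᵥ* A) c| := by
  classical
  obtain ⟨κ, hκ0, hκ⟩ := exists_uniform_sum_abs_le_vecMul V (n * m + n + m)
  refine ⟨κ + κ * (1 + n * κ), by positivity, ?_⟩
  intro I ρ _ _ A b hV hzero hE hrow hcol hcard u
  let k : I → ℕ := fun i => (Finset.univ.filter fun r => b r = i).card
  have hk : ∀ i, m ≤ k i := le_card_block hzero hcol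
  let S : Finset I := Finset.univ.filter fun i => m < k i
  have hmemS : ∀ i, i ∈ S ↔ m < k i := fun i => by simp [S]
  have hksum : ∑ i, k i = Fintype.card I * m + n := by
    rw [← hcard]
    exact (Finset.card_eq_sum_card_fiberwise (f := b) (s := Finset.univ) (t := Finset.univ)
      (fun _ _ => by simp)).symm
  have hexc : ∑ i, (k i - m) = n := by
    have : ∑ i, (k i - m) + ∑ _i : I, m = ∑ i, k i := by
      rw [← Finset.sum_add_distrib]
      exact Finset.sum_congr rfl fun i _ => Nat.sub_add_cancel (hk i)
    simp only [Finset.sum_const, Finset.card_univ, smul_eq_mul] at this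
    omega
  have hexcS : ∑ i ∈ S, (k i - m) ≤ n :=
    hexc ▸ Finset.sum_le_sum_of_subset (Finset.subset_univ S)
  have hScard : S.card ≤ n := by
    refine le_trans ?_ hexcS
    rw [Finset.card_eq_sum_ones]
    exact Finset.sum_le_sum fun i hi => by have := (hmemS i).1 hi; omega
  have hSm : S.card * m ≤ n * m := Nat.mul_le_mul_right m hScard
  have hSrows : (Finset.univ.filter fun r => b r ∈ S).card ≤ n * m + n := by
    have h1 : (Finset.univ.filter fun r => b r ∈ S).card = ∑ i ∈ S, k i := by
      rw [Finset.card_eq_sum_card_fiberwise (f := b) (t := S) (fun r hr => by simpa using hr)]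
      refine Finset.sum_congr rfl fun i hi => congrArg Finset.card ?_
      ext r
      simp only [Finset.mem_filter, Finset.mem_univ, true_and, and_iff_right_iff_imp]
      rintro rfl
      exact hi
    have h2 : ∑ i ∈ S, k i = ∑ i ∈ S, (k i - m) + S.card * m := by
      rw [← smul_eq_mul, ← Finset.sum_const, ← Finset.sum_add_distrib]
      exact Finset.sum_congr rfl fun i _ => (Nat.sub_add_cancel (hk i)).symm
    omega
  set w := u ᵥ* A with hw
  set uS : ρ → ℝ := fun r => if b r ∈ S then u r else 0 with huS
  set uT : ρ → ℝ := fun r => if b r ∈ Sᶜ then u r else 0 with huT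
  have hsplit : u = uS + uT := by
    ext r
    by_cases h : b r ∈ S <;> simp [huS, huT, h]
  have hblock : ∀ i ∈ Sᶜ, ∑ r, |if b r ∈ ({i} : Finset I) then u r else 0| ≤
      κ * ∑ j, |w (Sum.inl (i, j))| := by
    intro i hi
    have hki : k i = m := by
      have := hk i
      have := (hmemS i).not.1 (Finset.mem_compl.1 hi)
      omega
    have h := hκ A hV (Finset.univ.filter fun r => b r = i)
      (Finset.univ.image fun j => Sum.inl (i, j)) (by change k i ≤ _; omega)
      (Finset.card_image_le.trans (by simp))
      (fun v hv hvA => square_block_vecMul_eq_zero hzero hcol hki v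
        (fun r hr => hv r (by simpa using hr)) (fun j => hvA _ (by simp)))
      (fun r => if b r ∈ ({i} : Finset I) then u r else 0)
      (fun r hr => by simpa using fun h => absurd h (by simpa using hr))
    rw [Finset.sum_image (fun j _ j' _ h => by simpa using h)] at h
    simp only [vecMul_restrict_blocks hzero, Finset.mem_singleton_self, if_true] at h
    exact h
  have hT : ∑ r, |uT r| ≤ κ * ∑ i ∈ Sᶜ, ∑ j, |w (Sum.inl (i, j))| := by
    rw [Finset.mul_sum]
    refine le_trans (le_of_eq ?_) (Finset.sum_le_sum hblock)
    rw [Finset.sum_comm]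
    refine Finset.sum_congr rfl fun r _ => ?_
    simp [huT, apply_ite abs]
  have hS : ∑ r, |uS r| ≤ κ * (∑ i ∈ S, ∑ j, |w (Sum.inl (i, j))| +
      ∑ j, |(uS ᵥ* A) (Sum.inr j)|) := by
    have h := hκ A hV (Finset.univ.filter fun r => b r ∈ S)
      ((S ×ˢ Finset.univ).disjSum Finset.univ) (by omega)
      (by simp only [Finset.card_disjSum, Finset.card_product, Finset.card_univ,
            Fintype.card_fin]
          omega)
      (fun v hv hvA => hrow v (by
        have hvS : v = fun r => if b r ∈ S then v r else 0 := by
          ext r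
          by_cases h : b r ∈ S
          · simp [h]
          · simp [h, hv r (by simpa using h)]
        ext c
        rcases c with ⟨i, j⟩ | j
        · by_cases hi : i ∈ S
          · exact hvA _ (by simp [hi])
          · rw [hvS, vecMul_restrict_blocks hzero, if_neg hi]; rfl
        · exact hvA _ (by simp)))
      uS (fun r hr => if_neg (by simpa using hr))
    rw [Finset.sum_disjSum, Finset.sum_product] at h
    refine h.trans (le_of_eq ?_)
    congr 2
    refine Finset.sum_congr rfl fun i hi => Finset.sum_congr rfl fun j _ => ?_
    rw [huS, vecMul_restrict_blocks hzero, if_pos hi]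
  have hcoup : ∑ j, |(uS ᵥ* A) (Sum.inr j)| ≤ ∑ j, |w (Sum.inr j)| + n * ∑ r, |uT r| := by
    have h1 : ∀ j, |(uS ᵥ* A) (Sum.inr j)| ≤ |w (Sum.inr j)| + ∑ r, |uT r| := by
      intro j
      have h2 : (uS ᵥ* A) (Sum.inr j) = w (Sum.inr j) - (uT ᵥ* A) (Sum.inr j) := by
        rw [hw, hsplit, Matrix.add_vecMul, Pi.add_apply, add_sub_cancel_right]
      have h3 : |(uT ᵥ* A) (Sum.inr j)| ≤ ∑ r, |uT r| := by
        refine (Finset.abs_sum_le_sum_abs _ _).trans (Finset.sum_le_sum fun r _ => ?_)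
        rw [abs_mul]
        exact mul_le_of_le_one_right (abs_nonneg _) (hE r j)
      rw [h2]
      exact (abs_sub _ _).trans (by gcongr)
    refine (Finset.sum_le_sum fun j _ => h1 j).trans (le_of_eq ?_)
    simp [Finset.sum_add_distrib]
  have hsum : ∑ r, |u r| ≤ ∑ r, |uS r| + ∑ r, |uT r| := by
    rw [← Finset.sum_add_distrib]
    exact Finset.sum_le_sum fun r _ => by
      rw [hsplit]; exact abs_add_le _ _
  have hW : ∑ c, |w c| = ∑ i ∈ S, ∑ j, |w (Sum.inl (i, j))| +
      ∑ i ∈ Sᶜ, ∑ j, |w (Sum.inl (i, j))| + ∑ j, |w (Sum.inr j)| := by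
    rw [Fintype.sum_sum_type, Fintype.sum_prod_type, Finset.sum_add_sum_compl]
  have hp : 0 ≤ ∑ i ∈ S, ∑ j, |w (Sum.inl (i, j))| := by positivity
  have hq : 0 ≤ ∑ i ∈ Sᶜ, ∑ j, |w (Sum.inl (i, j))| := by positivity
  have hr : 0 ≤ ∑ j, |w (Sum.inr j)| := by positivity
  have hTW : ∑ r, |uT r| ≤ κ * ∑ c, |w c| :=
    hT.trans (by gcongr; linarith)
  calc ∑ r, |u r| ≤ ∑ r, |uS r| + ∑ r, |uT r| := hsum
    _ ≤ κ * (∑ c, |w c| + n * (κ * ∑ c, |w c|)) + κ * ∑ c, |w c| := by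
      refine add_le_add (hS.trans ?_) hTW
      have : n * ∑ r, |uT r| ≤ n * (κ * ∑ c, |w c|) := by gcongr
      exact mul_le_mul_of_nonneg_left (by linarith) hκ0
    _ = _ := by ring

/-- **Theorem (uniform bound for stage-1 FCBMs).**  For a finite set `𝒱 ⊆ ℝ`
and positive integers `m, n₁` there is a constant `κ`, depending only on `𝒱`,
`m` and `n₁` (and in particular not on the number of diagonal blocks), such
that for every stage-1 FCBM `𝔸` with characterization numbers `(m, n₁)` whose
entries lie in `𝒱`, every maximal nonsingular submatrix `𝔸̂` of `𝔸` (a square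
invertible row-selection) and every row vector `u`,
`‖u‖₁ ≤ κ ‖u 𝔸̂‖₁`. -/
theorem fcbm_stage1_row_bound (V : Finset ℝ) (m n1 : ℕ) (hm : 0 < m) (hn1 : 0 < n1) :
    ∃ κ : ℝ, 0 < κ ∧
      ∀ (R C : Type) [Fintype R] [Fintype C] [DecidableEq C]
        (M : Matrix R C ℝ),
        IsFCBM m (fun _ => n1) 1 R C inferInstance inferInstance M →
        (∀ i j, M i j ∈ V) →
        ∀ g : C ↪ R, IsUnit (M.submatrix g id).det →
        ∀ u : C → ℝ,
          ∑ c, |u c| ≤ κ * ∑ c, |(u ᵥ* M.submatrix g id) c| := by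
  obtain ⟨κ, hκ0, hκ⟩ := exists_sum_abs_le_vecMul_of_blocks V m n1
  refine ⟨κ + 1, by positivity, ?_⟩
  intro R C _ _ _ M hM hV g hg u
  obtain ⟨-, N, p, B, fB, e, f, hzero, hE, hB⟩ := hM
  rcases isEmpty_or_nonempty C with hC | ⟨⟨c₀⟩⟩
  · simp
  obtain ⟨⟨σ⟩, -⟩ := hB (e (g c₀)).1
  obtain rfl : p = m := by simpa using Fintype.card_congr σ
  have hunit : IsUnit (M.submatrix g id) := (Matrix.isUnit_iff_isUnit_det _).2 hg
  let A : Matrix C ((Fin N × Fin p) ⊕ Fin n1) ℝ := (M.submatrix g id).submatrix id f.symm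
  have hvec : ∀ v c, (v ᵥ* A) c = (v ᵥ* M.submatrix g id) (f.symm c) := fun _ _ => rfl
  have h := hκ A (fun c => (e (g c)).1) (fun _ _ => hV _ _)
    (fun r i j hr => hzero (g r) i j hr)
    (fun r j => by
      rcases hE (g r) j with h | h
      · simp [A, h]
      · simp [A, h])
    (fun v hv => by
      refine Matrix.vecMul_injective_iff_isUnit.2 hunit ?_
      simp only [Matrix.zero_vecMul]
      ext c
      simpa [hvec] using congrFun hv (f c))
    (fun v hv => by
      have h0 : v ∘ f = 0 := by
        refine Matrix.mulVec_injective_iff_isUnit.2 hunit ?_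
        simp only [Matrix.mulVec_zero]
        rw [← hv, Matrix.submatrix_mulVec_equiv]
        rfl
      ext c
      simpa using congrFun h0 (f.symm c))
    (by simpa using Fintype.card_congr f) u
  simp only [hvec] at h
  rw [f.symm.sum_comp (fun c => |(u ᵥ* M.submatrix g id) c|)] at h
  refine h.trans ?_
  gcongr
  linarith
end

section
/- Let 𝒱 be a finite set of real numbers, k ≥ 1 an integer, and m, n₁,…,n_k positive integers. There exists a constant κ, depending only on 𝒱 and (m, n₁,…,n_k), such that: for every stage-k FCBM 𝔸 with characterization numbers (m, n₁,…,n_k) all of whose entries lie in 𝒱, every maximal nonsingular submatrix 𝔸̂ of 𝔸, and every row vector u with as many entries as 𝔸̂ has rows, ‖u‖₁ ≤ κ ‖u 𝔸̂‖₁. In particular, κ is independent of the numbers and sizes of the diagonal blocks at every level of the recursive block structure of 𝔸. -/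
open Matrix

/-- All entries of `u` lie in `F`, and at most `s` of them are nonzero. -/
def SparseIn {ι : Type} (F : Finset ℝ) (s : ℕ) (u : ι → ℝ) : Prop :=
  (∀ i, u i ∈ F) ∧ ∃ T : Finset ι, T.card ≤ s ∧ ∀ i, i ∉ T → u i = 0

namespace SparseIn

variable {ι κ : Type} {F G : Finset ℝ} {s t : ℕ} {u v : ι → ℝ}

lemma of_fintype [Fintype ι] (hu : ∀ i, u i ∈ F) : SparseIn F (Fintype.card ι) u :=
  ⟨hu, Finset.univ, le_rfl, by simp⟩

open scoped Classical Pointwise in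
lemma sub (hu : SparseIn F s u) (hv : SparseIn G t v) : SparseIn (F - G) (s + t) (u - v) := by
  obtain ⟨hu, T, hT, hT0⟩ := hu
  obtain ⟨hv, T', hT', hT0'⟩ := hv
  refine ⟨fun i => Finset.sub_mem_sub (hu i) (hv i), T ∪ T',
    (Finset.card_union_le _ _).trans (by omega), fun i hi => ?_⟩
  simp only [Finset.mem_union, not_or] at hi
  simp [hT0 i hi.1, hT0' i hi.2]

lemma comp_injective (hu : SparseIn F s u) {f : κ → ι} (hf : Function.Injective f) :
    SparseIn F s (u ∘ f) := by
  obtain ⟨hu, T, hT, hT0⟩ := hu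
  exact ⟨fun i => hu _, T.preimage f hf.injOn,
    (Finset.card_le_card_of_injOn f (by simp [Set.MapsTo]) hf.injOn).trans hT, fun i hi => hT0 _ (by simpa using hi)⟩

lemma sum_abs_le [Fintype ι] (hu : SparseIn F s u) : ∑ i, |u i| ≤ s * ∑ x ∈ F, |x| := by
  obtain ⟨hu, T, hT, hT0⟩ := hu
  have hle : ∀ i ∈ T, |u i| ≤ ∑ x ∈ F, |x| := fun i _ =>
    Finset.single_le_sum (f := fun x : ℝ => |x|) (fun x _ => abs_nonneg x) (hu i)
  calc ∑ i, |u i| = ∑ i ∈ T, |u i| :=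
        (Finset.sum_subset (Finset.subset_univ T) fun i _ hi => by simp [hT0 i hi]).symm
    _ ≤ T.card • ∑ x ∈ F, |x| := Finset.sum_le_card_nsmul _ _ _ hle
    _ ≤ s * ∑ x ∈ F, |x| := by
        rw [nsmul_eq_mul]
        have : (T.card : ℝ) ≤ s := by exact_mod_cast hT
        exact mul_le_mul_of_nonneg_right this (Finset.sum_nonneg fun x _ => abs_nonneg x)

end SparseIn

open scoped Classical Pointwise in
lemma exists_finset_forall_sum_mem (F : Finset ℝ) (s : ℕ) :
    ∃ G : Finset ℝ, ∀ (ι : Type) (T : Finset ι) (u : ι → ℝ), T.card ≤ s →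
      (∀ i ∈ T, u i ∈ F) → ∑ i ∈ T, u i ∈ G := by
  induction s with
  | zero =>
    refine ⟨{0}, fun ι T u hT _ => ?_⟩
    obtain rfl : T = ∅ := by simpa using hT
    simp
  | succ s ih =>
    obtain ⟨G, hG⟩ := ih
    refine ⟨G ∪ (F + G), fun ι T u hT hu => ?_⟩
    rcases T.eq_empty_or_nonempty with rfl | ⟨a, ha⟩
    · exact Finset.mem_union_left _ (hG ι ∅ u (by simp) (by simp))
    · rw [← Finset.add_sum_erase T u ha]
      refine Finset.mem_union_right _ (Finset.add_mem_add (hu a ha) (hG ι _ u ?_ ?_))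
      · rw [Finset.card_erase_of_mem ha]; omega
      · exact fun i hi => hu i (Finset.mem_of_mem_erase hi)

open scoped Classical Pointwise in
lemma exists_finset_forall_dotProduct_mem (F V : Finset ℝ) (s : ℕ) :
    ∃ G : Finset ℝ, ∀ (ι : Type) [Fintype ι] (u v : ι → ℝ), SparseIn F s u →
      (∀ i, v i ∈ V) → u ⬝ᵥ v ∈ G := by
  obtain ⟨G, hG⟩ := exists_finset_forall_sum_mem (F * V) s
  refine ⟨G, fun ι _ u v hu hv => ?_⟩
  obtain ⟨hu, T, hT, hT0⟩ := hu
  rw [dotProduct, ← Finset.sum_subset (Finset.subset_univ T) fun i _ hi => by simp [hT0 i hi]]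
  exact hG ι T _ hT fun i _ => Finset.mul_mem_mul (hu i) (hv i)

lemma eq_vecMul_inv {ι : Type} [Fintype ι] [DecidableEq ι] {A : Matrix ι ι ℝ} (hA : IsUnit A)
    (u : ι → ℝ) : (u ᵥ* A) ᵥ* A⁻¹ = u := by
  rw [vecMul_vecMul, mul_nonsing_inv _ ((isUnit_iff_isUnit_det A).1 hA), vecMul_one]

lemma vecMul_inv_vecMul {ι : Type} [Fintype ι] [DecidableEq ι] {A : Matrix ι ι ℝ} (hA : IsUnit A)
    (u : ι → ℝ) : (u ᵥ* A⁻¹) ᵥ* A = u := by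
  rw [vecMul_vecMul, nonsing_inv_mul _ ((isUnit_iff_isUnit_det A).1 hA), vecMul_one]

open scoped Classical in
/-- Square systems of a fixed size with data from a finite set have solutions with entries in a
finite set. -/
lemma exists_finset_forall_solution_mem (V F : Finset ℝ) (n : ℕ) :
    ∃ G : Finset ℝ, ∀ (ι : Type) [Fintype ι] [DecidableEq ι] (_ : Nonempty (ι ≃ Fin n))
      (A : Matrix ι ι ℝ), IsUnit A → (∀ i j, A i j ∈ V) →
      ∀ u : ι → ℝ, (∀ i, (u ᵥ* A) i ∈ F) → ∀ i, u i ∈ G := by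
  refine ⟨(Fintype.piFinset (fun _ : Fin n => Fintype.piFinset fun _ : Fin n => V) ×ˢ
    (Fintype.piFinset (fun _ : Fin n => F) ×ˢ Finset.univ)).image
      (fun x => (x.2.1 ᵥ* (Matrix.of x.1)⁻¹) x.2.2), ?_⟩
  rintro ι _ _ ⟨e⟩ A hA hAV u hu i
  refine Finset.mem_image.2 ⟨(A.submatrix e.symm e.symm, (u ᵥ* A) ∘ e.symm, e i), ?_, ?_⟩
  · exact Finset.mem_product.2 ⟨Fintype.mem_piFinset.2 fun _ => Fintype.mem_piFinset.2 fun _ =>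
      hAV _ _, by simp [Fintype.mem_piFinset, hu]⟩
  · have h := eq_vecMul_inv ((isUnit_submatrix_equiv e.symm e.symm).2 hA) (u ∘ e.symm)
    rw [submatrix_vecMul_equiv] at h
    have h2 : (u ∘ e.symm) ∘ e.symm.symm = u := by ext; simp
    rw [h2] at h
    exact (congrFun h (e i)).trans (by simp)

/-- `φ` controls the row system of `A`: solutions with right-hand side sparse in `F`
are sparse in a finite set determined by `φ`. -/
def SolvesSparsely {ι : Type} [Fintype ι] (φ : Finset ℝ → ℕ → Finset ℝ × ℕ)
    (A : Matrix ι ι ℝ) : Prop :=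
  ∀ (F : Finset ℝ) (s : ℕ) (u : ι → ℝ), SparseIn F s (u ᵥ* A) → SparseIn (φ F s).1 (φ F s).2 u

open scoped Classical Pointwise in
lemma exists_solvesSparsely_fromBlocks (φ : Finset ℝ → ℕ → Finset ℝ × ℕ) (V : Finset ℝ)
    (n L : ℕ) :
    ∃ ψ : Finset ℝ → ℕ → Finset ℝ × ℕ, ∀ (Q : Type) [Fintype Q] [DecidableEq Q]
      (H : Matrix Q Q ℝ) (E : Matrix Q (Fin n) ℝ) (X : Matrix (Fin n) Q ℝ)
      (Y : Matrix (Fin n) (Fin n) ℝ), IsUnit H → SolvesSparsely φ H →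
      (∀ q j, E q j ∈ V) → (∀ r, SparseIn V L (X r)) → (∀ r j, Y r j ∈ V) →
      IsUnit (fromBlocks H E X Y) → SolvesSparsely ψ (fromBlocks H E X Y) := by
  suffices h : ∀ F s, ∃ p : Finset ℝ × ℕ, ∀ (Q : Type) [Fintype Q] [DecidableEq Q]
      (H : Matrix Q Q ℝ) (E : Matrix Q (Fin n) ℝ) (X : Matrix (Fin n) Q ℝ)
      (Y : Matrix (Fin n) (Fin n) ℝ), IsUnit H → SolvesSparsely φ H →
      (∀ q j, E q j ∈ V) → (∀ r, SparseIn V L (X r)) → (∀ r j, Y r j ∈ V) →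
      IsUnit (fromBlocks H E X Y) → ∀ u : Q ⊕ Fin n → ℝ,
      SparseIn F s (u ᵥ* fromBlocks H E X Y) → SparseIn p.1 p.2 u by
    choose ψ hψ using h
    exact ⟨ψ, fun Q _ _ H E X Y hH hφ hE hX hY hu F s => hψ F s Q H E X Y hH hφ hE hX hY hu⟩
  intro F s
  obtain ⟨G₁, hG₁⟩ := exists_finset_forall_dotProduct_mem (φ V L).1 V (φ V L).2
  obtain ⟨G₂, hG₂⟩ := exists_finset_forall_dotProduct_mem (φ F s).1 V (φ F s).2
  obtain ⟨G₃, hG₃⟩ := exists_finset_forall_solution_mem (V - G₁) (F - G₂) n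
  obtain ⟨G₄, hG₄⟩ := exists_finset_forall_dotProduct_mem G₃ V (Fintype.card (Fin n))
  refine ⟨((φ (F - G₄) (s + n * L)).1 ∪ G₃, (φ (F - G₄) (s + n * L)).2 + n), ?_⟩
  intro Q _ _ H E X Y hH hφ hE hX hY hU u hw
  set a : Q → ℝ := u ∘ Sum.inl
  set b : Fin n → ℝ := u ∘ Sum.inr
  set w := u ᵥ* fromBlocks H E X Y with hwdef
  have hwl : w ∘ Sum.inl = a ᵥ* H + b ᵥ* X := by
    rw [hwdef, vecMul_fromBlocks]; rfl
  have hwr : w ∘ Sum.inr = a ᵥ* E + b ᵥ* Y := by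
    rw [hwdef, vecMul_fromBlocks]; rfl
  have hz : ∀ F s (x : Q → ℝ), SparseIn F s x → SparseIn (φ F s).1 (φ F s).2 (x ᵥ* H⁻¹) :=
    fun F s x hx => hφ F s _ (by rwa [vecMul_inv_vecMul hH])
  have hS : IsUnit (Y - X * H⁻¹ * E) := by
    let := hH.invertible
    have := isUnit_fromBlocks_iff_of_invertible₁₁.1 hU
    rwa [invOf_eq_nonsing_inv] at this
  have hbS : b ᵥ* (Y - X * H⁻¹ * E) = w ∘ Sum.inr - ((w ∘ Sum.inl) ᵥ* H⁻¹) ᵥ* E := by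
    rw [hwl, hwr, add_vecMul, eq_vecMul_inv hH, add_vecMul, vecMul_sub, vecMul_vecMul,
      vecMul_vecMul, Matrix.mul_assoc]
    abel
  have hbG : ∀ i, b i ∈ G₃ := by
    refine hG₃ (Fin n) ⟨Equiv.refl _⟩ _ hS (fun i j => ?_) b (fun i => ?_)
    · exact Finset.sub_mem_sub (hY i j)
        (hG₁ Q (X i ᵥ* H⁻¹) (fun q => E q j) (hz _ _ _ (hX i)) (fun q => hE q j))
    · rw [hbS]
      exact Finset.sub_mem_sub (hw.1 _)
        (hG₂ Q _ (fun q => E q i) (hz _ _ _ (hw.comp_injective Sum.inl_injective))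
          (fun q => hE q i))
  have hbX : SparseIn G₄ (n * L) (b ᵥ* X) := by
    refine ⟨fun q => hG₄ (Fin n) b _ (.of_fintype hbG) (fun r => (hX r).1 q), ?_⟩
    choose T hT hT0 using fun r => (hX r).2
    refine ⟨Finset.univ.biUnion T, ?_, fun q hq => ?_⟩
    · simpa using Finset.card_biUnion_le_card_mul Finset.univ T L (fun r _ => hT r)
    · simp only [Finset.mem_biUnion, Finset.mem_univ, true_and, not_exists] at hq
      have hXq : (fun r => X r q) = 0 := funext fun r => hT0 r q (hq r)
      rw [vecMul, hXq, dotProduct_zero]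
  have haH : a ᵥ* H = w ∘ Sum.inl - b ᵥ* X := by rw [hwl]; abel
  obtain ⟨haF, T, hT, hT0⟩ : SparseIn (φ (F - G₄) (s + n * L)).1 (φ (F - G₄) (s + n * L)).2 a :=
    hφ _ _ a (haH ▸ (hw.comp_injective Sum.inl_injective).sub hbX)
  refine ⟨?_, T.disjSum Finset.univ, ?_, ?_⟩
  · rintro (q | r)
    · exact Finset.mem_union_left _ (haF q)
    · exact Finset.mem_union_right _ (hbG r)
  · simpa using hT
  · rintro (q | r) h
    · exact hT0 q (by simpa using h)
    · simp at h

open scoped Classical in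
/-- Sparse solvability passes from the diagonal blocks to a block-diagonal matrix. -/
lemma solvesSparsely_of_blocks {φ : Finset ℝ → ℕ → Finset ℝ × ℕ} {N p : ℕ}
    {H : Matrix (Fin N × Fin p) (Fin N × Fin p) ℝ}
    (h0 : ∀ i j i' j', i ≠ i' → H (i, j) (i', j') = 0)
    (hu : ∀ i, IsUnit (H.submatrix (Prod.mk i) (Prod.mk i)))
    (hs : ∀ i, SolvesSparsely φ (H.submatrix (Prod.mk i) (Prod.mk i))) :
    IsUnit H ∧ SolvesSparsely (fun F s => ((φ F s).1, s * (φ F s).2)) H := by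
  have hblock : ∀ (y : Fin N × Fin p → ℝ) (i : Fin N),
      (fun j => y (i, j)) ᵥ* H.submatrix (Prod.mk i) (Prod.mk i) =
        (y ᵥ* H) ∘ Prod.mk i := by
    intro y i
    ext j
    simp only [vecMul, dotProduct, Function.comp_apply, submatrix_apply]
    rw [Fintype.sum_prod_type, Finset.sum_eq_single i]
    · exact fun i' _ hi' => Finset.sum_eq_zero fun j' _ => by rw [h0 _ _ _ _ hi', mul_zero]
    · simp
  have hzero : ∀ (y : Fin N × Fin p → ℝ) (i : Fin N), (∀ j, (y ᵥ* H) (i, j) = 0) →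
      ∀ j, y (i, j) = 0 := by
    intro y i h
    have h1 : (y ᵥ* H) ∘ Prod.mk i = 0 := funext h
    have h2 := eq_vecMul_inv (hu i) (fun j => y (i, j))
    rw [hblock, h1, zero_vecMul] at h2
    exact fun j => (congrFun h2 j).symm
  constructor
  · rw [isUnit_iff_isUnit_det, isUnit_iff_ne_zero, Ne, ← exists_vecMul_eq_zero_iff]
    rintro ⟨v, hv, hvH⟩
    exact hv (funext fun ⟨i, j⟩ => hzero v i (fun j => by simp [hvH]) j)
  · intro F s y hy
    have hyi : ∀ i, SparseIn (φ F s).1 (φ F s).2 (fun j => y (i, j)) := fun i =>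
      hs i F s _ (by rw [hblock]; exact hy.comp_injective (Prod.mk_right_injective i))
    obtain ⟨-, T, hT, hT0⟩ := hy
    choose S hS hS0 using fun i => (hyi i).2
    refine ⟨fun ⟨i, j⟩ => (hyi i).1 j,
      (T.image Prod.fst).biUnion fun i => (S i).image (Prod.mk i), ?_, ?_⟩
    · refine (Finset.card_biUnion_le_card_mul _ _ (φ F s).2
        fun i _ => Finset.card_image_le.trans (hS i)).trans ?_
      exact Nat.mul_le_mul_right _ (Finset.card_image_le.trans hT)
    · rintro ⟨i, j⟩ hij
      by_cases hi : i ∈ T.image Prod.fst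
      · refine hS0 i j fun hj => hij ?_
        exact Finset.mem_biUnion.2 ⟨i, hi, Finset.mem_image_of_mem _ hj⟩
      · refine hzero y i (fun j => hT0 _ fun hj => hi ?_) j
        exact Finset.mem_image.2 ⟨_, hj, rfl⟩

/-- A matrix with independent columns has an invertible square selection of rows. -/
lemma exists_isUnit_submatrix {ι : Type} [Fintype ι] {p : ℕ} {X : Matrix ι (Fin p) ℝ}
    (hX : LinearIndependent ℝ X.col) : ∃ b : Fin p → ι, IsUnit (X.submatrix b id) := by
  have hr : Module.finrank ℝ (Submodule.span ℝ (Set.range X.row)) = p := by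
    rw [← rank_eq_finrank_span_row, ← rank_transpose]
    simpa using LinearIndependent.rank_matrix (M := Xᵀ) hX
  obtain ⟨f, hf, -, hli⟩ := Submodule.exists_fun_fin_finrank_span_eq ℝ (Set.range X.row)
  choose b hb using hf
  refine ⟨b ∘ Fin.cast hr.symm, linearIndependent_rows_iff_isUnit.1 ?_⟩
  have h : (X.submatrix (b ∘ Fin.cast hr.symm) id).row = f ∘ Fin.cast hr.symm :=
    funext fun _ => hb _
  rw [h]
  exact hli.comp _ (Fin.cast_injective _)

/-- The rows of an FCBM have a bounded number of nonzero entries. -/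
lemma IsFCBM.exists_row_support_bound (m : ℕ) (ns : ℕ → ℕ) (k : ℕ) :
    ∃ L : ℕ, ∀ (R C : Type) (fR : Fintype R) (fC : Fintype C) (M : Matrix R C ℝ),
      IsFCBM m ns k R C fR fC M → ∀ r, ∃ T : Finset C, T.card ≤ L ∧ ∀ c, c ∉ T → M r c = 0 := by
  classical
  induction k with
  | zero =>
    refine ⟨m, fun R C fR fC M hM r => ⟨Finset.univ, ?_, by simp⟩⟩
    obtain ⟨⟨e⟩, -⟩ := hM
    simp [Fintype.card_congr e]
  | succ k ih =>
    obtain ⟨L, hL⟩ := ih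
    refine ⟨L + ns (k + 1), fun R C fR fC M hM r => ?_⟩
    obtain ⟨-, N, p, B, fB, e, f, h0, -, hB⟩ := hM
    obtain ⟨T, hT, hT0⟩ := hL _ _ _ _ _ (hB (e r).1) (e r).2
    refine ⟨((T.image (Prod.mk (e r).1)).disjSum Finset.univ).image f.symm, ?_, fun c hc => ?_⟩
    · refine Finset.card_image_le.trans ?_
      simpa using Finset.card_image_le.trans hT
    · obtain ⟨x, rfl⟩ := f.symm.surjective c
      rcases x with ⟨i, j⟩ | j
      · by_cases hi : (e r).1 = i
        · subst hi
          have := hT0 j (by simpa using hc)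
          simpa using this
        · exact h0 r i j hi
      · simp at hc

open scoped Classical in
lemma exists_solvesSparsely_of_isFCBM (V : Finset ℝ) (m : ℕ) (ns : ℕ → ℕ) (k : ℕ) :
    ∃ φ : Finset ℝ → ℕ → Finset ℝ × ℕ, ∀ (R C : Type) (fR : Fintype R) (fC : Fintype C)
      [DecidableEq C] (M : Matrix R C ℝ), IsFCBM m ns k R C fR fC M → (∀ i j, M i j ∈ V) →
      ∀ g : C → R, IsUnit (M.submatrix g id) → SolvesSparsely φ (M.submatrix g id) := by
  induction k with
  | zero =>
    choose G hG using fun F => exists_finset_forall_solution_mem V F m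
    refine ⟨fun F _ => (G F, m), fun R C fR fC _ M hM hV g hg F s u hu => ?_⟩
    obtain ⟨⟨e⟩, -⟩ := hM
    have := SparseIn.of_fintype (hG F C ⟨e⟩ _ hg (fun i j => hV _ _) u hu.1)
    rwa [Fintype.card_congr e, Fintype.card_fin] at this
  | succ k ih =>
    obtain ⟨φ, hφ⟩ := ih
    obtain ⟨L, hL⟩ := IsFCBM.exists_row_support_bound m ns (k + 1)
    obtain ⟨ψ, hψ⟩ := exists_solvesSparsely_fromBlocks
      (fun F s => ((φ F s).1, s * (φ F s).2)) V (ns (k + 1)) L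
    refine ⟨ψ, fun R C fR fC _ M hM hV g hg => ?_⟩
    have hrow : ∀ r, SparseIn V L (M r) := fun r => ⟨hV r, hL _ _ _ _ _ hM r⟩
    obtain ⟨-, N, p, B, fB, e, f, h0, -, hB⟩ := hM
    -- in each block, an invertible choice of rows among those selected by `g`
    have hcol : ∀ i, LinearIndependent ℝ
        (((M.submatrix g id).submatrix id fun j => f.symm (Sum.inl (i, j))).col) := fun i =>
      (linearIndependent_cols_iff_isUnit.2 hg).comp (fun j => f.symm (Sum.inl (i, j)))
        (f.symm.injective.comp (Sum.inl_injective.comp (Prod.mk_right_injective i)))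
    choose b hb using fun i => exists_isUnit_submatrix (hcol i)
    have hbdet := fun i => ((isUnit_iff_isUnit_det _).1 (hb i)).ne_zero
    have hbi : ∀ i j, (e (g (b i j))).1 = i := by
      intro i j
      by_contra hne
      exact hbdet i (det_eq_zero_of_row_eq_zero j fun j' => h0 _ _ _ hne)
    have hbinj : Function.Injective fun q : Fin N × Fin p => b q.1 q.2 := by
      rintro ⟨i, j⟩ ⟨i', j'⟩ h
      obtain rfl : i = i' := by
        rw [← hbi i j, ← hbi i' j']
        exact congrArg (fun c => (e (g c)).1) h
      refine congrArg (Prod.mk i) ?_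
      by_contra hne
      exact hbdet i (det_zero_of_row_eq hne (funext fun x => by
        simp only [submatrix_apply]; exact congrArg (fun c => M (g c) _) h))
    -- complete these rows to an enumeration of all the selected rows
    obtain ⟨ρ, hρ⟩ : ∃ ρ : (Fin N × Fin p) ⊕ Fin (ns (k + 1)) ≃ C,
        ∀ q, ρ (Sum.inl q) = b q.1 q.2 := by
      let F : (Fin N × Fin p) ⊕ Fin (ns (k + 1)) → C :=
        Sum.elim (fun q => b q.1 q.2) fun j => f.symm (Sum.inr j)
      obtain ⟨ρ, hρ⟩ := Set.MapsTo.exists_equiv_extend_of_card_eq (t := Finset.univ)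
        (by rw [Finset.card_univ, Fintype.card_congr f]) (s := Set.range Sum.inl) (f := F)
        (by intro x _; simp)
        (by
          rintro _ ⟨q, rfl⟩ _ ⟨q', rfl⟩ h
          exact congrArg Sum.inl (hbinj h))
      exact ⟨ρ.trans (Equiv.subtypeUnivEquiv Finset.mem_univ), fun q => hρ _ ⟨q, rfl⟩⟩
    set P := (M.submatrix g id).submatrix ρ f.symm with hP
    have hPu : IsUnit P := (isUnit_submatrix_equiv ρ f.symm).2 hg
    have hblk : ∀ i, P.toBlocks₁₁.submatrix (Prod.mk i) (Prod.mk i) =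
        (M.submatrix g id).submatrix (b i) fun j => f.symm (Sum.inl (i, j)) := by
      intro i
      ext j j'
      simp [hP, toBlocks₁₁, hρ]
    have hH := solvesSparsely_of_blocks (φ := φ) (H := P.toBlocks₁₁)
      (fun i j i' j' hne => by
        simp only [hP, toBlocks₁₁, of_apply, submatrix_apply, hρ]
        exact h0 _ _ _ (by rw [hbi]; exact hne))
      (fun i => by rw [hblk]; exact hb i)
      (fun i => by
        let Mi : Matrix (B i) (Fin p) ℝ :=
          fun br bj => M (e.symm ⟨i, br⟩) (f.symm (Sum.inl (i, bj)))
        let gi : Fin p → B i := fun j => hbi i j ▸ (e (g (b i j))).2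
        have hgi : ∀ j, e.symm ⟨i, gi j⟩ = g (b i j) := by
          intro j
          rw [Equiv.symm_apply_eq]
          exact Sigma.ext (hbi i j).symm (by simp [gi])
        have heq : Mi.submatrix gi id = P.toBlocks₁₁.submatrix (Prod.mk i) (Prod.mk i) := by
          rw [hblk]
          ext j j'
          exact congrArg (fun r => M r (f.symm (Sum.inl (i, j')))) (hgi j)
        rw [← heq]
        refine hφ (B i) (Fin p) (fB i) _ Mi (hB i) (fun _ _ => hV _ _) gi ?_
        rw [heq, hblk]
        exact hb i)
    have hPs : SolvesSparsely ψ P := by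
      rw [← fromBlocks_toBlocks P]
      exact hψ _ _ _ _ _ hH.1 hH.2 (fun _ _ => hV _ _)
        (fun r => (hrow _).comp_injective (f.symm.injective.comp Sum.inl_injective))
        (fun _ _ => hV _ _) (by rwa [fromBlocks_toBlocks])
    intro F s u hu
    have h1 := hPs F s (u ∘ ρ) (by
      rw [hP, submatrix_vecMul_equiv]
      have : (u ∘ ρ) ∘ ρ.symm = u := by ext; simp
      rw [this]
      exact hu.comp_injective f.symm.injective)
    have h2 := h1.comp_injective ρ.symm.injective
    have : (u ∘ ρ) ∘ ρ.symm = u := by ext; simp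
    rwa [this] at h2

/-- **Theorem (uniform bound for stage-`k` FCBMs).**  For a finite set
`𝒱 ⊆ ℝ`, `k ≥ 1` and positive integers `m, n₁, …, n_k` there is a constant
`κ`, depending only on `𝒱` and `(m, n₁,…,n_k)` (in particular not on the
numbers and sizes of the diagonal blocks at any level of the recursive block
structure), such that for every stage-`k` FCBM `𝔸` with characterization
numbers `(m, n₁,…,n_k)` whose entries lie in `𝒱`, every maximal nonsingular
submatrix `𝔸̂` of `𝔸` (a square invertible row-selection) and every row
vector `u`, `‖u‖₁ ≤ κ ‖u 𝔸̂‖₁`. -/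
theorem fcbm_stagek_row_bound (V : Finset ℝ) (k : ℕ) (hk : 1 ≤ k) (m : ℕ) (hm : 0 < m)
    (ns : ℕ → ℕ) (hns : ∀ l, 1 ≤ l → l ≤ k → 0 < ns l) :
    ∃ κ : ℝ, 0 < κ ∧
      ∀ (R C : Type) [Fintype R] [Fintype C] [DecidableEq C]
        (M : Matrix R C ℝ),
        IsFCBM m ns k R C inferInstance inferInstance M →
        (∀ i j, M i j ∈ V) →
        ∀ g : C ↪ R, IsUnit (M.submatrix g id).det →
        ∀ u : C → ℝ,
          ∑ c, |u c| ≤ κ * ∑ c, |(u ᵥ* M.submatrix g id) c| := by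
  obtain ⟨φ, hφ⟩ := exists_solvesSparsely_of_isFCBM V m ns k
  set p := φ {0, 1} 1
  have hb : (0 : ℝ) ≤ p.2 * ∑ x ∈ p.1, |x| :=
    mul_nonneg (Nat.cast_nonneg _) (Finset.sum_nonneg fun x _ => abs_nonneg x)
  refine ⟨p.2 * ∑ x ∈ p.1, |x| + 1, by linarith, fun R C _ _ _ M hM hV g hg u => ?_⟩
  set A := M.submatrix g id
  have hA : IsUnit A := (isUnit_iff_isUnit_det A).2 hg
  have hrow : ∀ c, ∑ j, |A⁻¹ c j| ≤ p.2 * ∑ x ∈ p.1, |x| := by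
    intro c
    refine SparseIn.sum_abs_le (hφ R C _ _ M hM hV g hA {0, 1} 1 (A⁻¹ c) ?_)
    have h : A⁻¹ c ᵥ* A = Pi.single c 1 := by
      rw [← vecMul_inv_vecMul hA (Pi.single c 1), single_one_vecMul]
      rfl
    rw [h]
    refine ⟨fun i => ?_, {c}, by simp, fun i hi => ?_⟩
    · by_cases hi : i = c
      · subst hi; simp
      · simp [hi]
    · exact Pi.single_eq_of_ne (by simpa using hi) _
  set w := u ᵥ* A with hw
  calc ∑ j, |u j| = ∑ j, |(w ᵥ* A⁻¹) j| := by rw [hw, eq_vecMul_inv hA]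
    _ ≤ ∑ j, ∑ c, |w c| * |A⁻¹ c j| := Finset.sum_le_sum fun j _ =>
        (Finset.abs_sum_le_sum_abs _ _).trans_eq (Finset.sum_congr rfl fun c _ => abs_mul _ _)
    _ = ∑ c, |w c| * ∑ j, |A⁻¹ c j| := by
        rw [Finset.sum_comm]
        simp only [Finset.mul_sum]
    _ ≤ ∑ c, |w c| * (p.2 * ∑ x ∈ p.1, |x| + 1) := Finset.sum_le_sum fun c _ =>
        mul_le_mul_of_nonneg_left ((hrow c).trans (by linarith)) (abs_nonneg _)
    _ = (p.2 * ∑ x ∈ p.1, |x| + 1) * ∑ c, |w c| := by rw [← Finset.sum_mul, mul_comm]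
end

section
/- Let A be an n × m matrix with nonnegative integer entries, Q ∈ ℝ^n, and let B, 𝔹 ∈ ℤ^m satisfy B ≥ 𝔹 ≥ 0 componentwise and A𝔹 ≥ Q componentwise. If for every index i with B_i > 𝔹_i there exists an index j with A_{ji} ≥ 1 and (A B)_j − Q_j < A_{ji}, then B = 𝔹. (In the paper's terms: under the allocation principle, if no product's backlog is strictly below its target, then every product's backlog equals its target.) -/
open Matrix

/-- **Theorem (allocation principle).**  Let `A` have nonnegative integer
entries, `Q ∈ ℝ^n`, and let the integer vectors `B ≥ 𝔹 ≥ 0` satisfy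
`A𝔹 ≥ Q`.  If for every index `i` with `B_i > 𝔹_i` there is a row `j` with
`A_{ji} ≥ 1` and `(AB)_j − Q_j < A_{ji}`, then `B = 𝔹`: if no product's
backlog is strictly below its target, every backlog equals its target. -/
theorem allocation_backlog_eq_target
    (m n : ℕ) (A : Matrix (Fin n) (Fin m) ℝ)
    (hA : ∀ j i, ∃ q : ℕ, A j i = (q : ℝ))
    (Q : Fin n → ℝ) (B 𝔹 : Fin m → ℤ)
    (hB𝔹 : ∀ i, 𝔹 i ≤ B i) (h𝔹0 : ∀ i, 0 ≤ 𝔹 i)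
    (hQ : ∀ j, Q j ≤ (A *ᵥ fun i => (𝔹 i : ℝ)) j)
    (hcond : ∀ i, 𝔹 i < B i →
      ∃ j, 1 ≤ A j i ∧ (A *ᵥ fun i' => (B i' : ℝ)) j - Q j < A j i) :
    B = 𝔹 := by
  funext i
  by_contra hne
  have hlt : 𝔹 i < B i := lt_of_le_of_ne (hB𝔹 i) (Ne.symm hne)
  obtain ⟨j, hji, hj⟩ := hcond i hlt
  have hterm : ∀ k, 0 ≤ A j k * ((B k : ℝ) - 𝔹 k) := fun k => by
    obtain ⟨q, hq⟩ := hA j k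
    have hk : (𝔹 k : ℝ) ≤ B k := by exact_mod_cast hB𝔹 k
    exact mul_nonneg (hq ▸ q.cast_nonneg) (sub_nonneg.2 hk)
  have hsum : A j i * ((B i : ℝ) - 𝔹 i) ≤
      (A *ᵥ fun k => (B k : ℝ)) j - (A *ᵥ fun k => (𝔹 k : ℝ)) j := by
    simp only [mulVec, dotProduct, ← Finset.sum_sub_distrib, ← mul_sub]
    exact Finset.single_le_sum (f := fun k => A j k * ((B k : ℝ) - 𝔹 k))
      (fun k _ => hterm k) (Finset.mem_univ i)
  have hone : (𝔹 i : ℝ) + 1 ≤ B i := by exact_mod_cast hlt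
  have hle : A j i ≤ A j i * ((B i : ℝ) - 𝔹 i) :=
    le_mul_of_one_le_right (by linarith) (by linarith)
  linarith [hQ j]
end

section
/- Let A^k (1 ≤ k ≤ K) be matrices with nonnegative entries, A^k of size n_k × m, and let A be the stacked n × m matrix (n = n₁+…+n_K); assume every row and every column of A contains a strictly positive entry. Let c ∈ ℝ^m be strictly positive, let x ∈ ℝ^m with x ≥ 0, let y^k ∈ ℝ^{n_k}, and let y ∈ ℝ^n denote the stacked vector of the y^k. Then every optimal solution z* of the linear program max{ c·z : z ∈ ℝ^m, z ≤ x, A^k z ≤ y^k for 1 ≤ k ≤ K } satisfies, for every coordinate i, z*_i ≥ −α̲, where α̲ := max_{1 ≤ j ≤ n} ( |y_j| + ∑_{i'=1}^m A_{j i'} x_{i'} ) / min{ A_{j i'} : A_{j i'} > 0 }. Consequently, for every α ≥ α̲ the linear program with the additional constraints z_i ≥ −α (1 ≤ i ≤ m) has the same optimal value as the original one. -/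
open Matrix

/-- The smallest positive entry of a finite family having a positive entry is positive. -/
lemma sInf_pos_entries_pos {ι : Type*} [Finite ι] (a : ι → ℝ) (h : ∃ i, 0 < a i) :
    0 < sInf { r : ℝ | 0 < r ∧ ∃ i, a i = r } := by
  obtain ⟨i, hi⟩ := h
  have hfin : { r : ℝ | 0 < r ∧ ∃ i, a i = r }.Finite :=
    (Set.finite_range a).subset fun r hr => hr.2
  have hne : { r : ℝ | 0 < r ∧ ∃ i, a i = r }.Nonempty := ⟨a i, hi, i, rfl⟩
  exact (hne.csInf_mem hfin).1

lemma sInf_pos_entries_le {ι : Type*} (a : ι → ℝ) {i : ι} (hi : 0 < a i) :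
    sInf { r : ℝ | 0 < r ∧ ∃ i, a i = r } ≤ a i :=
  csInf_le ⟨0, fun _ hr => hr.1.le⟩ ⟨hi, i, rfl⟩

/-- Raising the coordinates of `z` to at least `-β` preserves a constraint `a ⬝ᵥ z ≤ y` with
nonnegative coefficients, if `β` is large compared with the positive coefficients. -/
lemma dotProduct_max_neg_le {ι : Type*} [Fintype ι] {a x z : ι → ℝ} {y β : ℝ}
    (ha : ∀ i, 0 ≤ a i) (hx : ∀ i, 0 ≤ x i) (hβ : 0 ≤ β)
    (hbound : ∀ i, 0 < a i → |y| + ∑ i', a i' * x i' ≤ a i * β)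
    (hzx : z ≤ x) (hz : a ⬝ᵥ z ≤ y) :
    (a ⬝ᵥ fun i => max (z i) (-β)) ≤ y := by
  classical
  by_cases h : ∃ i, 0 < a i ∧ z i < -β
  · obtain ⟨i, hai, hzi⟩ := h
    have hrest : ∑ j ∈ Finset.univ.erase i, a j * max (z j) (-β)
        ≤ ∑ j ∈ Finset.univ.erase i, a j * x j :=
      Finset.sum_le_sum fun j _ => mul_le_mul_of_nonneg_left
        (max_le (hzx j) (by linarith [hx j])) (ha j)
    have h₁ := Finset.add_sum_erase Finset.univ (fun j => a j * max (z j) (-β)) (Finset.mem_univ i)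
    have h₂ := Finset.add_sum_erase Finset.univ (fun j => a j * x j) (Finset.mem_univ i)
    simp only [max_eq_right hzi.le] at h₁ h₂
    have h₃ := mul_nonneg (ha i) (hx i)
    have h₄ := hbound i hai
    have h₅ := neg_abs_le y
    simp only [dotProduct]
    linarith
  · push Not at h
    refine le_of_eq_of_le (Finset.sum_congr rfl fun i _ => ?_) hz
    rcases (ha i).eq_or_lt with hi | hi
    · simp [← hi]
    · simp only [max_eq_left (h i hi)]

/-- **Theorem (lower bound on optimal allocations).**  For the LP
`max{ c·z : z ≤ x, A^k z ≤ y^k (1 ≤ k ≤ K) }` with `c > 0`, `x ≥ 0` and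
nonnegative `A^k` whose stacked matrix has a strictly positive entry in every
row and every column, every optimal solution `z*` satisfies `z*_i ≥ −α̲` with
`α̲ = max_j (|y_j| + ∑_{i'} A_{j i'} x_{i'}) / min{ A_{j i'} : A_{j i'} > 0 }`,
the maximum running over all rows `j` of the stacked matrix; consequently for
every `α ≥ α̲`, adding the constraints `z_i ≥ −α` does not change the optimal
value. -/
theorem lp_solution_lower_bound
    (m K : ℕ) (hm : 0 < m) (hK : 0 < K)
    (n : ℕ → ℕ)
    (A : (k : ℕ) → Matrix (Fin (n k)) (Fin m) ℝ)
    (hA : ∀ k, 1 ≤ k → k ≤ K → ∀ j i, 0 ≤ A k j i)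
    (hrow : ∀ k, 1 ≤ k → k ≤ K → ∀ j : Fin (n k), ∃ i, 0 < A k j i)
    (hcol : ∀ i : Fin m, ∃ k, 1 ≤ k ∧ k ≤ K ∧ ∃ j, 0 < A k j i)
    (c : Fin m → ℝ) (hc : ∀ i, 0 < c i)
    (x : Fin m → ℝ) (hx : ∀ i, 0 ≤ x i)
    (y : (k : ℕ) → Fin (n k) → ℝ)
    (αlow : ℝ)
    (hαlow : αlow = sSup { r : ℝ | ∃ k, 1 ≤ k ∧ k ≤ K ∧ ∃ j : Fin (n k),
        r = (|y k j| + ∑ i', A k j i' * x i') /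
              sInf { a : ℝ | 0 < a ∧ ∃ i', A k j i' = a } }) :
    (∀ z : Fin m → ℝ,
        (z ≤ x ∧ ∀ k, 1 ≤ k → k ≤ K → A k *ᵥ z ≤ y k) →
        (∀ w : Fin m → ℝ,
          (w ≤ x ∧ ∀ k, 1 ≤ k → k ≤ K → A k *ᵥ w ≤ y k) → c ⬝ᵥ w ≤ c ⬝ᵥ z) →
        ∀ i, -αlow ≤ z i) ∧
    (∀ α : ℝ, αlow ≤ α →
      sSup { r : ℝ | ∃ z : Fin m → ℝ,
          (z ≤ x ∧ ∀ k, 1 ≤ k → k ≤ K → A k *ᵥ z ≤ y k) ∧ r = c ⬝ᵥ z }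
        = sSup { r : ℝ | ∃ z : Fin m → ℝ,
            (z ≤ x ∧ (∀ k, 1 ≤ k → k ≤ K → A k *ᵥ z ≤ y k) ∧ ∀ i, -α ≤ z i) ∧
            r = c ⬝ᵥ z }) := by
  let S := { r : ℝ | ∃ k, 1 ≤ k ∧ k ≤ K ∧ ∃ j : Fin (n k),
        r = (|y k j| + ∑ i', A k j i' * x i') /
              sInf { a : ℝ | 0 < a ∧ ∃ i', A k j i' = a } }
  have hSfin : S.Finite := by
    refine ((Set.finite_Icc 1 K).biUnion fun k _ => Set.finite_range fun j : Fin (n k) =>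
      (|y k j| + ∑ i', A k j i' * x i') /
        sInf { a : ℝ | 0 < a ∧ ∃ i', A k j i' = a }).subset ?_
    rintro r ⟨k, hk1, hkK, j, rfl⟩
    exact Set.mem_biUnion (Set.mem_Icc.2 ⟨hk1, hkK⟩) ⟨j, rfl⟩
  have hnum : ∀ k, 1 ≤ k → k ≤ K → ∀ j, 0 ≤ |y k j| + ∑ i', A k j i' * x i' :=
    fun k hk1 hkK j => add_nonneg (abs_nonneg _)
      (Finset.sum_nonneg fun i _ => mul_nonneg (hA k hk1 hkK j i) (hx i))
  have hα0 : 0 ≤ αlow := by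
    rw [hαlow]
    refine Real.sSup_nonneg ?_
    rintro r ⟨k, hk1, hkK, j, rfl⟩
    exact div_nonneg (hnum k hk1 hkK j) (sInf_pos_entries_pos _ (hrow k hk1 hkK j)).le
  have hbound : ∀ k, 1 ≤ k → k ≤ K → ∀ j i, 0 < A k j i →
      |y k j| + ∑ i', A k j i' * x i' ≤ A k j i * αlow := by
    intro k hk1 hkK j i hi
    have hle : _ ≤ αlow := hαlow ▸ le_csSup hSfin.bddAbove ⟨k, hk1, hkK, j, rfl⟩
    rw [div_le_iff₀ (sInf_pos_entries_pos _ (hrow k hk1 hkK j)), mul_comm] at hle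
    exact hle.trans (mul_le_mul_of_nonneg_right (sInf_pos_entries_le (A k j) hi) hα0)
  have hfeas : ∀ z : Fin m → ℝ, (z ≤ x ∧ ∀ k, 1 ≤ k → k ≤ K → A k *ᵥ z ≤ y k) →
      (fun i => max (z i) (-αlow)) ≤ x ∧
        ∀ k, 1 ≤ k → k ≤ K → A k *ᵥ (fun i => max (z i) (-αlow)) ≤ y k :=
    fun z hz => ⟨fun i => max_le (hz.1 i) (by linarith [hx i]), fun k hk1 hkK j =>
      dotProduct_max_neg_le (hA k hk1 hkK j) hx hα0 (hbound k hk1 hkK j) hz.1 (hz.2 k hk1 hkK j)⟩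
  refine ⟨fun z hz hopt i => ?_, fun α hα => ?_⟩
  · by_contra! hi
    refine (hopt _ (hfeas z hz)).not_gt (Finset.sum_lt_sum
      (fun j _ => mul_le_mul_of_nonneg_left (le_max_left _ _) (hc j).le)
      ⟨i, Finset.mem_univ i, mul_lt_mul_of_pos_left (lt_max_of_lt_right hi) (hc i)⟩)
  · refine csSup_eq_csSup_of_forall_exists_le ?_ ?_
    · rintro r ⟨z, hz, rfl⟩
      exact ⟨_, ⟨_, ⟨(hfeas z hz).1, (hfeas z hz).2,
        fun i => (neg_le_neg hα).trans (le_max_right _ _)⟩, rfl⟩,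
        Finset.sum_le_sum fun j _ => mul_le_mul_of_nonneg_left (le_max_left _ _) (hc j).le⟩
    · rintro r ⟨z, hz, rfl⟩
      exact ⟨_, ⟨z, ⟨hz.1, hz.2.1⟩, rfl⟩, le_rfl⟩
end
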